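/- arXiv:2002.00494 — 2 statements merged into one kernel-verified Lean document; each statement's English description precedes it below -/
import Mathlib

section
/- A subgroup of GL_m(C) all of whose elements are virtually unipotent (some positive power of each element is unipotent) is virtually solvable, i.e., contains a solvable subgroup of finite index. -/
section

open scoped commutatorElement Matrix.Norms.Operator

theorem exists_one_add_pow_eq {R : Type*} [Ring R] (X : R) (k : ℕ) :
    ∃ Y, (1 + X) ^ k = 1 + k * X + X * X * Y := by
  induction k with
  | zero => exact ⟨0, by simp⟩
  | succ k ih =>
    obtain ⟨Y, hY⟩ := ih
    refine ⟨k + Y + Y * X, ?_⟩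
    have hc : X * (X * (k : R)) = k * (X * X) := by
      rw [← mul_assoc, (Nat.cast_commute k (X * X)).eq]
    rw [pow_succ, hY]
    simp only [mul_add, add_mul, mul_one, one_mul, Nat.cast_add, Nat.cast_one, mul_assoc, hc]
    abel

theorem Matrix.mul_apply_mem_mul {n R : Type*} [Fintype n] [CommRing R] {I J : Ideal R}
    {X Y : Matrix n n R} (hX : ∀ i j, X i j ∈ I) (hY : ∀ i j, Y i j ∈ J) (i j : n) :
    (X * Y) i j ∈ I * J := by
  rw [Matrix.mul_apply]
  exact Ideal.sum_mem _ fun k _ => Ideal.mul_mem_mul (hX i k) (hY k j)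

theorem Matrix.eq_zero_of_one_add_pow_eq_one {n R : Type*} [Fintype n] [DecidableEq n] [CommRing R]
    [IsNoetherianRing R] [IsDomain R] {I : Ideal R} [hI : I.IsMaximal] {l : ℕ} (hl : (l : R) ∉ I)
    {X : Matrix n n R} (hX : ∀ i j, X i j ∈ I) (h : (1 + X) ^ l = 1) : X = 0 := by
  obtain ⟨Y, hY⟩ := exists_one_add_pow_eq X l
  obtain ⟨u, t, ht, hu⟩ := hI.exists_inv hl
  have hlX : ∀ i j, (l : R) * X i j = -(X * X * Y) i j := by
    intro i j
    have h0 : (l : Matrix n n R) * X + X * X * Y = 0 := by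
      rw [h, add_assoc] at hY
      simpa using hY
    have h1 := congrFun (congrFun h0 i) j
    rw [← nsmul_eq_mul, Matrix.add_apply, Matrix.smul_apply, nsmul_eq_mul, Matrix.zero_apply] at h1
    linear_combination h1
  have key : ∀ k : ℕ, ∀ i j, X i j ∈ I ^ (k + 1) := by
    intro k
    induction k with
    | zero => simpa using hX
    | succ k ih =>
      intro i j
      have h2 : (X * X * Y) i j ∈ I ^ (k + 1 + 1) := by
        have := Matrix.mul_apply_mem_mul (J := ⊤) (Matrix.mul_apply_mem_mul ih hX)
          (Y := Y) (fun _ _ => trivial) i j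
        rwa [Ideal.mul_top, ← pow_succ] at this
      have h3 : t * X i j ∈ I ^ (k + 1 + 1) := by
        rw [pow_succ']
        exact Ideal.mul_mem_mul ht (ih i j)
      have h4 : X i j = t * X i j - u * (X * X * Y) i j := by
        linear_combination (-X i j) * hu + u * hlX i j
      rw [h4]
      exact sub_mem h3 (Ideal.mul_mem_left _ _ h2)
  ext i j
  have : X i j ∈ (⨅ k : ℕ, I ^ k : Ideal R) := by
    rw [Ideal.mem_iInf]
    rintro (_ | k)
    · simp
    · exact key k i j
  rwa [Ideal.iInf_pow_eq_bot_of_isDomain I hI.ne_top, Ideal.mem_bot] at this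

instance Int.isJacobsonRing : IsJacobsonRing ℤ := by
  rw [isJacobsonRing_iff_prime_eq]
  intro P hP
  by_cases h0 : P = ⊥
  · subst h0
    refine le_antisymm (fun x hx => ?_) Ideal.le_jacobson
    have h1 := Ideal.mem_jacobson_bot.1 hx x
    rw [Int.isUnit_iff] at h1
    rw [Ideal.mem_bot]
    rcases h1 with h1 | h1 <;> nlinarith [mul_self_nonneg x]
  · have := hP.isMaximal h0
    exact Ideal.jacobson_eq_self_of_isMaximal

theorem Ideal.finite_quotient_of_finiteType_int {R : Type*} [CommRing R] [Algebra.FiniteType ℤ R]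
    (I : Ideal R) [hI : I.IsMaximal] : Finite (R ⧸ I) := by
  let := Ideal.Quotient.field I
  have h1 : Algebra.FiniteType ℤ (R ⧸ I) := inferInstance
  have := finite_of_finite_type_of_isJacobsonRing ℤ (R ⧸ I)
  refine Module.finite_of_fg_torsion (R ⧸ I) fun x => ?_
  obtain ⟨p, hp⟩ := CharP.exists (R ⧸ I)
  have hp0 : p ≠ 0 := by
    rintro rfl
    have : CharZero (R ⧸ I) := CharP.charP_to_charZero _
    exact Int.not_isField (isField_of_isIntegral_of_isField
      (R := ℤ) (S := R ⧸ I) (algebraMap ℤ (R ⧸ I)).injective_int (Field.toIsField _))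
  refine ⟨⟨p, mem_nonZeroDivisors_of_ne_zero (by exact_mod_cast hp0)⟩, ?_⟩
  change (p : ℤ) • x = 0
  rw [zsmul_eq_mul, Int.cast_natCast, CharP.cast_eq_zero, zero_mul]

theorem Ideal.exists_isMaximal_not_mem {R : Type*} [CommRing R] [IsDomain R] [IsJacobsonRing R]
    {x : R} (hx : x ≠ 0) : ∃ I : Ideal R, I.IsMaximal ∧ x ∉ I := by
  by_contra! h
  have h1 : (⊥ : Ideal R).jacobson = ⊥ :=
    IsJacobsonRing.out inferInstance (Ideal.isPrime_bot (α := R)).isRadical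
  apply hx
  rw [← Ideal.mem_bot, ← h1, Ideal.jacobson, Ideal.mem_sInf]
  exact fun {I} hI => h I hI.2

theorem Matrix.finite_of_isOfFinOrder {n R : Type*} [Fintype n] [DecidableEq n] [CommRing R]
    [IsDomain R] [CharZero R] [Algebra.FiniteType ℤ R] (K : Subgroup (Matrix n n R)ˣ)
    (hK : ∀ g ∈ K, IsOfFinOrder g) : Finite K := by
  have : IsNoetherianRing R := Algebra.FiniteType.isNoetherianRing ℤ R
  have : IsJacobsonRing R := isJacobsonRing_of_finiteType (A := ℤ)
  obtain ⟨I, hI⟩ := Ideal.exists_maximal R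
  have := Ideal.finite_quotient_of_finiteType_int I
  obtain ⟨p, hp⟩ := CharP.exists (R ⧸ I)
  have hp0 : p ≠ 0 := CharP.char_ne_zero_of_finite (R ⧸ I) p
  obtain ⟨J, hJ, hpJ⟩ := Ideal.exists_isMaximal_not_mem (x := (p : R)) (by exact_mod_cast hp0)
  have := Ideal.finite_quotient_of_finiteType_int J
  let f : (Matrix n n R)ˣ →* (Matrix n n (R ⧸ I))ˣ × (Matrix n n (R ⧸ J))ˣ :=
    (Units.map (Ideal.Quotient.mk I).mapMatrix.toMonoidHom).prod
      (Units.map (Ideal.Quotient.mk J).mapMatrix.toMonoidHom)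
  have hker : ∀ g ∈ K, f g = 1 → g = 1 := by
    intro g hg hfg
    by_contra hne
    have ho : orderOf g ≠ 1 := by simpa using hne
    obtain ⟨l, hl, hdvd⟩ := Nat.exists_prime_and_dvd ho
    have hpos : 0 < orderOf g := (hK g hg).orderOf_pos
    set u := g ^ (orderOf g / l) with hu
    have hul : orderOf u = l := orderOf_pow_orderOf_div hpos.ne' hdvd
    have hfu : f u = 1 := by rw [hu, map_pow, hfg, one_pow]
    have hu1 : ((1 : Matrix n n R) + ((u : Matrix n n R) - 1)) ^ l = 1 := by
      rw [add_sub_cancel, ← Units.val_pow_eq_pow_val, ← hul, pow_orderOf_eq_one, Units.val_one]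
    have hu2 : (u : Matrix n n R) - 1 ≠ 0 := by
      rw [sub_ne_zero]
      intro h
      have : u = 1 := Units.ext h
      rw [this, orderOf_one] at hul
      exact hl.one_lt.ne hul
    have hmem : ∀ Q : Ideal R, ((u : Matrix n n R)).map (Ideal.Quotient.mk Q) = 1 →
        ∀ i j, ((u : Matrix n n R) - 1) i j ∈ Q := by
      intro Q hQ i j
      rw [← Ideal.Quotient.eq_zero_iff_mem]
      have := congrFun (congrFun hQ i) j
      simp only [Matrix.map_apply] at this
      rw [Matrix.sub_apply, map_sub, this, Matrix.one_apply, Matrix.one_apply]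
      split_ifs <;> simp
    have hI1 : ((u : Matrix n n R)).map (Ideal.Quotient.mk I) = 1 :=
      congrArg Units.val (congrArg Prod.fst hfu)
    have hJ1 : ((u : Matrix n n R)).map (Ideal.Quotient.mk J) = 1 :=
      congrArg Units.val (congrArg Prod.snd hfu)
    have hlI : (l : R) ∈ I := by
      by_contra hlI
      exact hu2 (Matrix.eq_zero_of_one_add_pow_eq_one hlI (hmem I hI1) hu1)
    have hlJ : (l : R) ∈ J := by
      by_contra hlJ
      exact hu2 (Matrix.eq_zero_of_one_add_pow_eq_one hlJ (hmem J hJ1) hu1)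
    have hpl : p ∣ l := by
      rw [← CharP.cast_eq_zero_iff (R ⧸ I) p l, ← map_natCast (Ideal.Quotient.mk I),
        Ideal.Quotient.eq_zero_iff_mem]
      exact hlI
    rcases (Nat.dvd_prime hl).1 hpl with h | h
    · have := CharP.cast_eq_zero (R ⧸ I) p
      rw [h, Nat.cast_one] at this
      exact one_ne_zero this
    · exact hpJ (h ▸ hlJ)
  have hinj : Function.Injective (f.comp K.subtype) := by
    rw [injective_iff_map_eq_one]
    exact fun g hg => Subtype.ext (hker g g.2 hg)
  exact Finite.of_injective _ hinj

/-- A finitely generated torsion linear group in characteristic zero is finite. -/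
theorem Matrix.finite_closure_of_isOfFinOrder {n F : Type*} [Fintype n] [DecidableEq n]
    [Field F] [CharZero F]
    {S : Set (Matrix n n F)ˣ} (hS : S.Finite)
    (hK : ∀ g ∈ Subgroup.closure S, IsOfFinOrder g) : Finite (Subgroup.closure S) := by
  let E : Set F := ⋃ g ∈ S, (Set.range fun ij : n × n => (g : Matrix n n F) ij.1 ij.2) ∪
    Set.range fun ij : n × n => ((g⁻¹ : (Matrix n n F)ˣ) : Matrix n n F) ij.1 ij.2
  have hE : E.Finite := hS.biUnion fun g _ => (Set.finite_range _).union (Set.finite_range _)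
  let R := Algebra.adjoin ℤ E
  have : Algebra.FiniteType ℤ R := by
    rw [← Subalgebra.fg_iff_finiteType]
    exact ⟨hE.toFinset, by simp [R]⟩
  let φ : Matrix n n R →* Matrix n n F := (R.val : R →+* F).mapMatrix.toMonoidHom
  have hφ : Function.Injective φ := Matrix.map_injective Subtype.val_injective
  let f : (Matrix n n R)ˣ →* (Matrix n n F)ˣ := Units.map φ
  have hf : Function.Injective f := Units.map_injective hφ
  have hle : Subgroup.closure S ≤ f.range := by
    rw [Subgroup.closure_le]
    intro g hg
    have h1 : ∀ i j, (g : Matrix n n F) i j ∈ R := fun i j =>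
      Algebra.subset_adjoin (Set.mem_biUnion hg (Or.inl ⟨(i, j), rfl⟩))
    have h2 : ∀ i j, ((g⁻¹ : (Matrix n n F)ˣ) : Matrix n n F) i j ∈ R := fun i j =>
      Algebra.subset_adjoin (Set.mem_biUnion hg (Or.inr ⟨(i, j), rfl⟩))
    let u : Matrix n n R := Matrix.of fun i j => ⟨_, h1 i j⟩
    let v : Matrix n n R := Matrix.of fun i j => ⟨_, h2 i j⟩
    have hu : φ u = g := rfl
    have hv : φ v = (g⁻¹ : (Matrix n n F)ˣ) := rfl
    refine ⟨⟨u, v, hφ ?_, hφ ?_⟩, Units.ext hu⟩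
    · rw [map_mul, hu, hv, map_one, Units.mul_inv]
    · rw [map_mul, hu, hv, map_one, Units.inv_mul]
  have hfin : Finite ((Subgroup.closure S).comap f) :=
    Matrix.finite_of_isOfFinOrder _ fun g hg => hf.isOfFinOrder_iff.1 (hK _ hg)
  rw [← Subgroup.map_comap_eq_self hle]
  exact Finite.of_surjective _ (f.subgroupMap_surjective _)

/-- Commuting idempotents at distance less than one coincide. -/
theorem IsIdempotentElem.eq_of_commute_of_norm_sub_lt_one {A : Type*} [NormedRing A] {P Q : A}
    (hP : IsIdempotentElem P) (hQ : IsIdempotentElem Q) (hPQ : Commute P Q) (h : ‖P - Q‖ < 1) :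
    P = Q := by
  set D := P - Q with hD
  have h3 : D * D * D = D := by
    have hP' : ∀ x, P * (P * x) = P * x := fun x => by rw [← mul_assoc, hP.eq]
    have hQP : Q * P = P * Q := hPQ.eq.symm
    simp only [hD, mul_sub, sub_mul, mul_assoc, hP.eq, hQ.eq, hP', hQP]
    abel
  have hn : ‖D‖ ≤ ‖D‖ * ‖D‖ * ‖D‖ := by
    conv_lhs => rw [← h3]
    exact (norm_mul_le _ _).trans (by gcongr; exact norm_mul_le _ _)
  have h0 : ‖D‖ = 0 := by
    by_contra hne
    have hpos : 0 < ‖D‖ := lt_of_le_of_ne (norm_nonneg _) (Ne.symm hne)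
    nlinarith [mul_lt_mul_of_pos_left h hpos]
  exact sub_eq_zero.1 (norm_eq_zero.1 h0)

theorem Commute.sum_pow_of_norm_lt {A : Type*} [NormedRing A] [NormedAlgebra ℂ A] {C : ℝ} {n : ℕ}
    (hn : n ≠ 0) {c : A} (hc : c ^ n = 1) (hC : ∀ k : ℕ, ‖c ^ k‖ ≤ C) (b : Aˣ)
    (hb' : ‖((b⁻¹ : Aˣ) : A)‖ ≤ C) (hb1 : 2 * C ^ 2 * ‖(b : A) - 1‖ < 1)
    (hcomm : Commute c (b * c * (b⁻¹ : Aˣ))) : Commute (∑ j ∈ Finset.range n, c ^ j) (b : A) := by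
  have hn' : (n : ℂ) ≠ 0 := by exact_mod_cast hn
  have hC0 : 0 ≤ C := (norm_nonneg _).trans (hC 0)
  set S := ∑ j ∈ Finset.range n, c ^ j with hS
  set P := (n : ℂ)⁻¹ • S with hP
  have hcS : c * S = S := by
    have := mul_geom_sum c n
    rw [hc, sub_self, ← hS, sub_mul, one_mul] at this
    exact sub_eq_zero.1 this
  have hcS' : ∀ j : ℕ, c ^ j * S = S := by
    intro j
    induction j with
    | zero => simp
    | succ j ih => rw [pow_succ, mul_assoc, hcS, ih]
  have hSS : S * S = (n : ℂ) • S := by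
    conv_lhs => enter [1]; rw [hS]
    rw [Finset.sum_mul, Finset.sum_congr rfl fun j _ => hcS' j]
    simp [Nat.cast_smul_eq_nsmul]
  have hPi : IsIdempotentElem P := by
    rw [IsIdempotentElem, hP, smul_mul_smul_comm, hSS, smul_smul]
    congr 1
    field_simp
  have hPn : ‖P‖ ≤ C := by
    have h1 : ‖S‖ ≤ n * C := by
      refine (norm_sum_le_of_le _ fun j _ => hC j).trans ?_
      simp
    rw [hP, norm_smul, norm_inv, Complex.norm_natCast]
    rw [inv_mul_le_iff₀ (by positivity)]
    exact h1
  set Q := (b : A) * P * (b⁻¹ : Aˣ) with hQ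
  have hQi : IsIdempotentElem Q := by
    rw [IsIdempotentElem, hQ]
    calc (b : A) * P * (b⁻¹ : Aˣ) * (b * P * (b⁻¹ : Aˣ))
        = b * (P * (((b⁻¹ : Aˣ) : A) * b) * P) * (b⁻¹ : Aˣ) := by simp only [mul_assoc]
      _ = b * P * (b⁻¹ : Aˣ) := by rw [Units.inv_mul, mul_one, hPi.eq]
  have hQsum : Q = (n : ℂ)⁻¹ • ∑ j ∈ Finset.range n, (b * c * (b⁻¹ : Aˣ)) ^ j := by
    simp only [Units.conj_pow, hQ, hP, hS, Finset.mul_sum, Finset.sum_mul, mul_smul_comm,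
      smul_mul_assoc]
  have hPQ : Commute P Q := by
    rw [hQsum, hP]
    refine Commute.smul_left (Commute.smul_right ?_ _) _
    exact Commute.sum_left _ _ _ fun i _ => Commute.sum_right _ _ _ fun j _ => hcomm.pow_pow i j
  have hsub : P - Q = (P * (b - 1) - (b - 1) * P) * (b⁻¹ : Aˣ) := by
    have : P = P * b * (b⁻¹ : Aˣ) := by rw [mul_assoc, Units.mul_inv, mul_one]
    conv_lhs => enter [1]; rw [this]
    rw [hQ, ← sub_mul]
    congr 1
    noncomm_ring
  have hlt : ‖P - Q‖ < 1 := by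
    refine lt_of_le_of_lt ?_ hb1
    rw [hsub]
    calc _ ≤ ‖P * ((b : A) - 1) - (b - 1) * P‖ * ‖((b⁻¹ : Aˣ) : A)‖ := norm_mul_le _ _
      _ ≤ (C * ‖(b : A) - 1‖ + ‖(b : A) - 1‖ * C) * C := by
        gcongr
        refine (norm_sub_le _ _).trans (add_le_add ?_ ?_) <;>
        · refine (norm_mul_le _ _).trans ?_
          gcongr
      _ = _ := by ring
  have heq : P = Q := hPi.eq_of_commute_of_norm_sub_lt_one hQi hPQ hlt
  have hPb : Commute P (b : A) := by
    rw [Commute, SemiconjBy]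
    conv_lhs => rw [heq, hQ, mul_assoc, Units.inv_mul, mul_one]
  have : S = (n : ℂ) • P := by rw [hP, smul_smul, mul_inv_cancel₀ hn', one_smul]
  rw [this]
  exact hPb.smul_left _

/-- Finite Fourier inversion for the powers of an element of finite order. -/
theorem smul_eq_sum_sum_smul_pow {A : Type*} [Ring A] [Algebra ℂ A] {n : ℕ} (hn : n ≠ 0) {a : A}
    (ha : a ^ n = 1) {w : ℂ} (hw : IsPrimitiveRoot w n) :
    (n : ℂ) • a = ∑ k ∈ Finset.range n,
      (w ^ k) ^ (n - 1) • ∑ j ∈ Finset.range n, (w ^ k • a) ^ j := by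
  have h1 : ∀ j ∈ Finset.range n, ∑ k ∈ Finset.range n, (w ^ k) ^ (n - 1) • (w ^ k • a) ^ j =
      if j = 1 % n then (n : ℂ) • a else 0 := by
    intro j hj
    rw [Finset.mem_range] at hj
    have h2 : ∀ k, (w ^ k) ^ (n - 1) • (w ^ k • a) ^ j = (w ^ (n - 1 + j)) ^ k • a ^ j := by
      intro k
      rw [smul_pow, smul_smul, ← pow_add, ← pow_mul, ← pow_mul, mul_comm k]
    simp only [h2]
    rw [← Finset.sum_smul]
    split_ifs with hj1
    · have h3 : w ^ (n - 1 + j) = 1 := by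
        rw [hw.pow_eq_one_iff_dvd]
        rcases Nat.lt_or_ge 1 n with h | h
        · rw [hj1, Nat.mod_eq_of_lt h]
          exact ⟨1, by omega⟩
        · have : n = 1 := by omega
          simp [this]
      have h4 : a ^ j = a := by
        rw [hj1, ← pow_mod_orderOf, Nat.mod_mod_of_dvd _ (orderOf_dvd_of_pow_eq_one ha),
          pow_mod_orderOf, pow_one]
      rw [h3, h4]
      simp
    · have h3 : w ^ (n - 1 + j) ≠ 1 := by
        rw [Ne, hw.pow_eq_one_iff_dvd]
        rintro ⟨q, hq⟩
        apply hj1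
        rcases Nat.lt_or_ge 1 n with h | h
        · rw [Nat.mod_eq_of_lt h]
          have : q = 1 := by
            have : n * q < n * 2 := by omega
            have := lt_of_mul_lt_mul_left this (Nat.zero_le _)
            have : q ≠ 0 := by rintro rfl; omega
            omega
          subst this
          omega
        · have : n = 1 := by omega
          subst this
          omega
      have h4 := geom_sum_mul (w ^ (n - 1 + j)) n
      rw [← pow_mul, mul_comm (n - 1 + j), pow_mul, hw.pow_eq_one, one_pow, sub_self] at h4
      rw [(mul_eq_zero.1 h4).resolve_right (sub_ne_zero.2 h3), zero_smul]
  simp only [Finset.smul_sum]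
  rw [Finset.sum_comm, Finset.sum_congr rfl h1, Finset.sum_ite_eq', if_pos]
  exact Finset.mem_range.2 (Nat.mod_lt _ (Nat.pos_of_ne_zero hn))

/-- A version of a lemma of Frobenius: if `a` has finite order and commutes with its conjugate by
an element `b` close to the identity, then it commutes with `b`. -/
theorem Commute.of_commute_conj {A : Type*} [NormedRing A] [NormedAlgebra ℂ A] {C : ℝ}
    {a b : Aˣ} (ha : IsOfFinOrder a) (hC : ∀ k : ℕ, ‖(a : A) ^ k‖ ≤ C)
    (hb' : ‖((b⁻¹ : Aˣ) : A)‖ ≤ C) (hb1 : 2 * C ^ 2 * ‖(b : A) - 1‖ < 1)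
    (hcomm : Commute a (b * a * b⁻¹)) : Commute a b := by
  obtain ⟨n, hn, han⟩ := isOfFinOrder_iff_pow_eq_one.1 ha
  have han' : (a : A) ^ n = 1 := by rw [← Units.val_pow_eq_pow_val, han, Units.val_one]
  have hw := Complex.isPrimitiveRoot_exp n hn.ne'
  have hcomm' : Commute (a : A) (b * a * (b⁻¹ : Aˣ)) := by
    exact_mod_cast hcomm.units_val
  have key := smul_eq_sum_sum_smul_pow hn.ne' han' hw
  set w := Complex.exp (2 * Real.pi * Complex.I / n)
  have h1 : Commute ((n : ℂ) • (a : A)) b := by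
    rw [key]
    refine Commute.sum_left _ _ _ fun k _ => Commute.smul_left ?_ _
    refine Commute.sum_pow_of_norm_lt (C := C) hn.ne' ?_ ?_ b hb' hb1 ?_
    · rw [smul_pow, han', ← pow_mul, mul_comm, pow_mul, hw.pow_eq_one, one_pow, one_smul]
    · intro j
      rw [smul_pow, norm_smul, norm_pow, norm_pow, hw.norm'_eq_one hn.ne', one_pow, one_pow,
        one_mul]
      exact hC j
    · rw [mul_smul_comm, smul_mul_assoc]
      exact (hcomm'.smul_left _).smul_right _
  have h2 := h1.smul_left (n : ℂ)⁻¹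
  rw [smul_smul, inv_mul_cancel₀ (by exact_mod_cast hn.ne'), one_smul] at h2
  exact Units.ext h2

theorem Units.norm_commutator_sub_one_le {A : Type*} [NormedRing A] {C : ℝ} {a c : Aˣ}
    (h : ‖((a⁻¹ * c⁻¹ : Aˣ) : A)‖ ≤ C) :
    ‖((⁅a, c⁆ : Aˣ) : A) - 1‖ ≤ 2 * C * ‖(a : A) - 1‖ * ‖(c : A) - 1‖ := by
  have h1 : ((⁅a, c⁆ : Aˣ) : A) - 1 =
      (((a : A) - 1) * (c - 1) - (c - 1) * (a - 1)) * (a⁻¹ * c⁻¹ : Aˣ) := by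
    have h2 : (1 : A) = c * a * (a⁻¹ * c⁻¹ : Aˣ) := by
      rw [← Units.val_mul, ← Units.val_mul]
      simp
    have h3 : ((⁅a, c⁆ : Aˣ) : A) = a * c * (a⁻¹ * c⁻¹ : Aˣ) := by
      rw [← Units.val_mul, ← Units.val_mul, commutatorElement_def, mul_assoc]
    rw [h3]
    conv_lhs => enter [2]; rw [h2]
    rw [← sub_mul]
    congr 1
    noncomm_ring
  rw [h1]
  calc _ ≤ ‖((a : A) - 1) * (c - 1) - (c - 1) * (a - 1)‖ * ‖((a⁻¹ * c⁻¹ : Aˣ) : A)‖ :=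
        norm_mul_le _ _
    _ ≤ (‖(a : A) - 1‖ * ‖(c : A) - 1‖ + ‖(c : A) - 1‖ * ‖(a : A) - 1‖) * C := by
      gcongr
      exact (norm_sub_le _ _).trans (add_le_add (norm_mul_le _ _) (norm_mul_le _ _))
    _ = _ := by ring

/-- In a bounded group, two elements close to the identity which generate a finite group
commute. -/
theorem commute_of_finite_closure {A : Type*} [NormedRing A] [NormedAlgebra ℂ A] {C : ℝ}
    (hC1 : 1 ≤ C) (K : Subgroup Aˣ) (hC : ∀ g ∈ K, ‖(g : A)‖ ≤ C) {a b : Aˣ} (ha : a ∈ K)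
    (hb : b ∈ K) (hfin : Finite (Subgroup.closure {a, b}))
    (ha1 : 4 * C ^ 2 * ‖(a : A) - 1‖ < 1) (hb1 : 4 * C ^ 2 * ‖(b : A) - 1‖ < 1) :
    Commute a b := by
  set L := Subgroup.closure {a, b} with hL
  have haL : a ∈ L := Subgroup.subset_closure (by simp)
  have hbL : b ∈ L := Subgroup.subset_closure (by simp)
  have hLK : L ≤ K := by
    rw [hL, Subgroup.closure_le]
    rintro x (rfl | rfl) <;> assumption
  let c : ℕ → Aˣ := fun k => (fun x => ⁅a, x⁆)^[k] b
  have hc : ∀ k, c (k + 1) = ⁅a, c k⁆ := fun k => Function.iterate_succ_apply' _ _ _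
  have hcL : ∀ k, c k ∈ L := by
    intro k
    induction k with
    | zero => exact hbL
    | succ k ih =>
      rw [hc, commutatorElement_def]
      exact mul_mem (mul_mem (mul_mem haL ih) (inv_mem haL)) (inv_mem ih)
  have hhalf : ∀ k, ‖(c (k + 1) : A) - 1‖ ≤ 1 / 2 * ‖(c k : A) - 1‖ := by
    intro k
    rw [hc]
    refine (Units.norm_commutator_sub_one_le
      (hC _ (hLK (mul_mem (inv_mem haL) (inv_mem (hcL k)))))).trans ?_
    gcongr
    nlinarith [norm_nonneg ((a : A) - 1), mul_nonneg (sub_nonneg.2 hC1) (norm_nonneg ((a : A) - 1)),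
      mul_nonneg (mul_nonneg (zero_le_one.trans hC1) (sub_nonneg.2 hC1))
        (norm_nonneg ((a : A) - 1))]
  have hsmall : ∀ k, 4 * C ^ 2 * ‖(c k : A) - 1‖ < 1 := by
    intro k
    induction k with
    | zero => exact hb1
    | succ k ih =>
      refine lt_of_le_of_lt ?_ ih
      gcongr
      linarith [hhalf k, norm_nonneg ((c k : A) - 1)]
  obtain ⟨N, hN⟩ : ∃ N, c N = 1 := by
    by_contra! hne
    have hanti : StrictAnti fun k => ‖(c k : A) - 1‖ := by
      refine strictAnti_nat_of_succ_lt fun k => ?_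
      have : 0 < ‖(c k : A) - 1‖ := norm_pos_iff.2 (sub_ne_zero.2 fun h => hne k (Units.ext h))
      linarith [hhalf k]
    have hinj : Function.Injective fun k => (⟨c k, hcL k⟩ : L) := by
      intro i j hij
      apply hanti.injective
      have : c i = c j := congrArg Subtype.val hij
      simp only [this]
    exact not_injective_infinite_finite _ hinj
  have hao : IsOfFinOrder a :=
    L.subtype.isOfFinOrder (isOfFinOrder_of_finite (⟨a, haL⟩ : L))
  have hback : ∀ k, Commute a (c k) → Commute a b := by
    intro k
    induction k with
    | zero => exact id
    | succ k ih =>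
      intro hk
      refine ih (Commute.of_commute_conj (C := C) hao ?_ ?_ ?_ ?_)
      · intro j
        rw [← Units.val_pow_eq_pow_val]
        exact hC _ (hLK (pow_mem haL j))
      · exact hC _ (hLK (inv_mem (hcL k)))
      · nlinarith [hsmall k, mul_nonneg (sq_nonneg C) (norm_nonneg ((c k : A) - 1))]
      · rw [hc, commutatorElement_def] at hk
        have h1 : Commute a (c k * a⁻¹ * (c k)⁻¹) := by
          have := (Commute.refl a).inv_right.mul_right hk
          simpa [mul_assoc] using this
        simpa [mul_assoc] using h1.inv_right
  exact hback N (hN ▸ Commute.one_right a)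

theorem eq_zero_of_isNilpotent_of_norm_one_add_pow_le {A : Type*} [NormedRing A]
    [NormedAlgebra ℝ A] {N : A} (hN : IsNilpotent N) {C : ℝ}
    (hC : ∀ j : ℕ, ‖(1 + N) ^ j‖ ≤ C) : N = 0 := by
  by_contra hne
  have : Nontrivial A := ⟨N, 0, hne⟩
  obtain ⟨r, hr, hr'⟩ : ∃ r, N ^ (r + 2) = 0 ∧ N ^ (r + 1) ≠ 0 := by
    have h2 : nilpotencyClass N ≠ 0 := (pos_nilpotencyClass_iff.2 hN).ne'
    have h3 : nilpotencyClass N ≠ 1 := by rwa [Ne, nilpotencyClass_eq_one]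
    obtain ⟨r, hr⟩ : ∃ r, nilpotencyClass N = r + 2 := ⟨nilpotencyClass N - 2, by omega⟩
    refine ⟨r, hr ▸ pow_nilpotencyClass hN, ?_⟩
    have := pow_pred_nilpotencyClass hN
    rwa [hr] at this
  have key : ∀ j : ℕ, (1 + N) ^ j * N ^ r = N ^ r + j • N ^ (r + 1) := by
    intro j
    induction j with
    | zero => simp
    | succ j ih =>
      rw [pow_succ', mul_assoc, ih, add_mul, one_mul, mul_add, mul_smul_comm, ← pow_succ',
        ← pow_succ', hr, smul_zero, add_zero, succ_nsmul, add_assoc]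
  obtain ⟨j, hj⟩ := exists_nat_gt ((C * ‖N ^ r‖ + ‖N ^ r‖) / ‖N ^ (r + 1)‖)
  rw [div_lt_iff₀ (norm_pos_iff.2 hr')] at hj
  have h1 : ‖j • N ^ (r + 1)‖ ≤ C * ‖N ^ r‖ + ‖N ^ r‖ := by
    rw [eq_sub_of_add_eq' (key j).symm]
    refine (norm_sub_le _ _).trans (add_le_add_left ?_ _)
    exact (norm_mul_le _ _).trans (by gcongr; exact hC j)
  rw [← Nat.cast_smul_eq_nsmul ℝ, norm_smul, Real.norm_natCast] at h1
  exact absurd h1 (not_le.2 hj)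

theorem Matrix.norm_trace_le_of_isNilpotent {n : Type*} [Fintype n] [DecidableEq n]
    {X : Matrix n n ℂ} {k : ℕ} (hk : 0 < k) (hX : IsNilpotent (X ^ k - 1)) :
    ‖X.trace‖ ≤ Fintype.card n := by
  have hroot : ∀ z ∈ X.charpoly.roots, ‖z‖ ≤ 1 := by
    intro z hz
    have hz' : Module.End.HasEigenvalue (Matrix.toLin' X) z := by
      rw [Module.End.hasEigenvalue_iff_isRoot_charpoly, Matrix.charpoly_toLin']
      exact Polynomial.isRoot_of_mem_roots hz
    obtain ⟨v, hv⟩ := hz'.exists_hasEigenvector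
    have hpow : ∀ (Y : Matrix n n ℂ) (y : ℂ), Y.mulVec v = y • v → ∀ j : ℕ,
        (Y ^ j).mulVec v = y ^ j • v := by
      intro Y y hY j
      induction j with
      | zero => simp
      | succ j ih =>
        rw [pow_succ, ← Matrix.mulVec_mulVec, hY, Matrix.mulVec_smul, ih, smul_smul,
          pow_succ']
    have h1 := hpow X z (by simpa using hv.apply_eq_smul) k
    obtain ⟨N, hN⟩ := hX
    have h2 := hpow (X ^ k - 1) (z ^ k - 1) (by
      rw [Matrix.sub_mulVec, h1, Matrix.one_mulVec, sub_smul, one_smul]) N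
    rw [hN, Matrix.zero_mulVec] at h2
    have h3 := (smul_eq_zero.1 h2.symm).resolve_right hv.2
    have h4 : z ^ k = 1 := sub_eq_zero.1 (eq_zero_of_pow_eq_zero h3)
    exact (Complex.norm_eq_one_of_pow_eq_one h4 hk.ne').le
  rw [Matrix.trace_eq_sum_roots_charpoly]
  have h5 : ∀ s : Multiset ℂ, (∀ z ∈ s, ‖z‖ ≤ 1) → ‖s.sum‖ ≤ Multiset.card s := by
    intro s
    induction s using Multiset.induction_on with
    | empty => simp
    | cons a s ih =>
      intro h
      rw [Multiset.sum_cons, Multiset.card_cons, Nat.cast_add, Nat.cast_one, add_comm _ (1 : ℝ)]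
      exact (norm_add_le _ _).trans (add_le_add (h _ (Multiset.mem_cons_self _ _))
        (ih fun z hz => h z (Multiset.mem_cons_of_mem hz)))
  refine (h5 _ hroot).trans ?_
  have := Polynomial.card_roots' X.charpoly
  rw [Matrix.charpoly_natDegree_eq_dim] at this
  exact_mod_cast this

theorem Matrix.exists_norm_le_of_norm_trace_le {n : Type*} [Fintype n] [DecidableEq n]
    {S : Set (Matrix n n ℂ)} (hS : Submodule.span ℂ S = ⊤) (c : ℝ) :
    ∃ C : ℝ, ∀ X : Matrix n n ℂ, (∀ Y ∈ S, ‖(X * Y).trace‖ ≤ c) → ‖X‖ ≤ C := by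
  obtain ⟨b, hbS, hb, hli⟩ := exists_linearIndependent ℂ S
  have : Finite b := hli.setFinite
  have := Fintype.ofFinite b
  let T : Matrix n n ℂ →ₗ[ℂ] (b → ℂ) :=
    LinearMap.pi fun y => Matrix.traceLinearMap n ℂ ℂ ∘ₗ LinearMap.mulRight ℂ (y : Matrix n n ℂ)
  have hT : ∀ X y, T X y = (X * (y : Matrix n n ℂ)).trace := fun X y => rfl
  have hker : LinearMap.ker T = ⊥ := by
    rw [LinearMap.ker_eq_bot']
    intro X hX
    rw [Matrix.ext_iff_trace_mul_right]
    intro Y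
    have hY : Y ∈ Submodule.span ℂ b := by rw [hb, hS]; trivial
    rw [Matrix.zero_mul, Matrix.trace_zero]
    induction hY using Submodule.span_induction with
    | mem y hy => exact congrFun hX ⟨y, hy⟩
    | zero => simp
    | add _ _ _ _ h1 h2 => rw [Matrix.mul_add, Matrix.trace_add, h1, h2, add_zero]
    | smul a _ _ h => rw [Matrix.mul_smul, Matrix.trace_smul, h, smul_zero]
  obtain ⟨K, -, hK⟩ := T.exists_antilipschitzWith hker
  refine ⟨K * max c 0, fun X hX => ?_⟩
  have h1 := hK.le_mul_dist X 0
  rw [map_zero, dist_zero_right, dist_zero_right] at h1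
  refine h1.trans ?_
  gcongr
  rw [pi_norm_le_iff_of_nonneg (le_max_right _ _)]
  exact fun y => (hX y (hbS y.2)).trans (le_max_left _ _)

/-- The subgroup generated by the elements of a bounded linear group which are close to the
identity has finite index. -/
theorem finiteIndex_closure_norm_sub_one_lt {G A : Type*} [Group G] [NormedRing A] [ProperSpace A]
    (f : G →* A) {C : ℝ} (hC : ∀ g, ‖f g‖ ≤ C) {ε : ℝ} (hε : 0 < ε) :
    (Subgroup.closure {g | ‖f g - 1‖ < ε}).FiniteIndex := by
  set H := Subgroup.closure {g | ‖f g - 1‖ < ε} with hH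
  have hC0 : 0 ≤ C := (norm_nonneg _).trans (hC 1)
  let δ := ε / (2 * (C + 1))
  have hδ : 0 < δ := by positivity
  have hb : Bornology.IsBounded (Set.range f) :=
    isBounded_iff_forall_norm_le.2 ⟨C, by rintro _ ⟨g, rfl⟩; exact hC g⟩
  have htb : TotallyBounded (Set.range f) :=
    hb.isCompact_closure.totallyBounded.subset subset_closure
  obtain ⟨t, ht, hcov⟩ := Metric.totallyBounded_iff.1 htb δ hδ
  have hex : ∀ g, ∃ y : t, ‖f g - y‖ < δ := by
    intro g
    obtain ⟨y, hy, hgy⟩ := Set.mem_iUnion₂.1 (hcov ⟨g, rfl⟩)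
    exact ⟨⟨y, hy⟩, by rwa [← dist_eq_norm]⟩
  choose c hc using hex
  have : Finite t := ht
  have hinj : Function.Injective fun q : G ⧸ H => c q.out := by
    intro q r hqr
    simp only at hqr
    rw [← q.out_eq', ← r.out_eq']
    refine QuotientGroup.eq.2 (Subgroup.subset_closure ?_)
    have h1 : ‖f r.out - f q.out‖ < 2 * δ := by
      have h2 := hc q.out
      rw [hqr, norm_sub_rev] at h2
      have h3 := norm_add_le (f r.out - c r.out) (c r.out - f q.out)
      rw [sub_add_sub_cancel] at h3
      linarith [hc r.out]
    have h4 : f (q.out⁻¹ * r.out) - 1 = f q.out⁻¹ * (f r.out - f q.out) := by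
      rw [mul_sub, ← map_mul, ← map_mul, inv_mul_cancel, map_one]
    rw [Set.mem_ofPred_eq, h4]
    calc _ ≤ C * (2 * δ) :=
          (norm_mul_le _ _).trans (mul_le_mul (hC _) h1.le (norm_nonneg _) hC0)
      _ < (C + 1) * (2 * δ) := by gcongr; linarith
      _ = ε := by simp only [δ]; field_simp
  have : Finite (G ⧸ H) := Finite.of_injective _ hinj
  exact Subgroup.finiteIndex_of_finite_quotient

theorem Matrix.exists_finiteIndex_commute_of_span_eq_top {n G : Type*} [Fintype n] [DecidableEq n]
    [Group G] (f : G →* Matrix n n ℂ) (hf : Submodule.span ℂ (Set.range f) = ⊤)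
    (hu : ∀ g, ∃ k : ℕ, 0 < k ∧ IsNilpotent (f g ^ k - 1)) :
    ∃ H : Subgroup G, H.FiniteIndex ∧ ∀ a ∈ H, ∀ b ∈ H, Commute (f a) (f b) := by
  have htr : ∀ g, ‖(f g).trace‖ ≤ Fintype.card n := fun g =>
    have ⟨_, hk, hN⟩ := hu g
    Matrix.norm_trace_le_of_isNilpotent hk hN
  obtain ⟨C', hC'⟩ := Matrix.exists_norm_le_of_norm_trace_le hf (Fintype.card n)
  have hC'' : ∀ g, ‖f g‖ ≤ C' := by
    refine fun g => hC' _ ?_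
    rintro _ ⟨h, rfl⟩
    rw [← map_mul]
    exact htr _
  set C := max C' 1
  have hC : ∀ g, ‖f g‖ ≤ C := fun g => (hC'' g).trans (le_max_left _ _)
  have hC1 : 1 ≤ C := le_max_right _ _
  have htors : ∀ g, ∃ k, 0 < k ∧ f g ^ k = 1 := by
    intro g
    obtain ⟨k, hk, hN⟩ := hu g
    refine ⟨k, hk, ?_⟩
    refine sub_eq_zero.1 (eq_zero_of_isNilpotent_of_norm_one_add_pow_le hN (C := C) fun j => ?_)
    rw [add_sub_cancel, ← map_pow, ← map_pow]
    exact hC _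
  let F : G →* (Matrix n n ℂ)ˣ := f.toHomUnits
  have hF : ∀ g, (F g : Matrix n n ℂ) = f g := fun g => rfl
  have hfin : ∀ g ∈ F.range, IsOfFinOrder g := by
    rintro _ ⟨g, rfl⟩
    obtain ⟨k, hk, h⟩ := htors g
    exact isOfFinOrder_iff_pow_eq_one.2 ⟨k, hk, Units.ext (by simpa [hF] using h)⟩
  have hprop : ProperSpace (Matrix n n ℂ) := FiniteDimensional.proper ℂ _
  have hε : 0 < 1 / (4 * C ^ 2) := by positivity
  refine ⟨_, finiteIndex_closure_norm_sub_one_lt f hC hε, ?_⟩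
  have hsmall : ∀ g, ‖f g - 1‖ < 1 / (4 * C ^ 2) → 4 * C ^ 2 * ‖(F g : Matrix n n ℂ) - 1‖ < 1 := by
    intro g hg
    rwa [lt_div_iff₀' (by positivity)] at hg
  have hgen : ∀ a, ‖f a - 1‖ < 1 / (4 * C ^ 2) → ∀ b, ‖f b - 1‖ < 1 / (4 * C ^ 2) →
      Commute (F a) (F b) := by
    intro a ha b hb
    refine commute_of_finite_closure hC1 F.range ?_ ⟨a, rfl⟩ ⟨b, rfl⟩ ?_ (hsmall a ha) (hsmall b hb)
    · rintro _ ⟨g, rfl⟩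
      exact hC g
    · refine Matrix.finite_closure_of_isOfFinOrder (by simp) fun g hg => hfin g ?_
      refine (Subgroup.closure_le _).2 ?_ hg
      rintro _ (rfl | rfl)
      exacts [⟨a, rfl⟩, ⟨b, rfl⟩]
  intro a ha b hb
  suffices Commute (F a) (F b) from this.units_val
  induction ha, hb using Subgroup.closure_induction₂ with
  | mem x y hx hy => exact hgen x hx y hy
  | one_left => simp
  | one_right => simp
  | mul_left _ _ _ _ _ _ h1 h2 => rw [map_mul]; exact h1.mul_left h2
  | mul_right _ _ _ _ _ _ h1 h2 => rw [map_mul]; exact h1.mul_right h2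
  | inv_left _ _ _ _ h => rw [map_inv]; exact h.inv_left
  | inv_right _ _ _ _ h => rw [map_inv]; exact h.inv_right

/-- **Burnside's theorem** on irreducible representations. -/
theorem Representation.IsIrreducible.span_range_eq_top {k G V : Type*} [Field k] [IsAlgClosed k]
    [Monoid G] [AddCommGroup V] [Module k V] [FiniteDimensional k V] (ρ : Representation k G V)
    [ρ.IsIrreducible] : Submodule.span k (Set.range ρ) = ⊤ := by
  rw [eq_top_iff]
  rintro f -
  have : FiniteDimensional k ρ.asModule := inferInstanceAs (FiniteDimensional k V)
  have hbij : Function.Bijective (algebraMap k (Module.End (MonoidAlgebra k G) ρ.asModule)) :=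
    IsSimpleModule.algebraMap_end_bijective_of_isAlgClosed k
  let f' : Module.End (Module.End (MonoidAlgebra k G) ρ.asModule) ρ.asModule :=
    { toFun := f
      map_add' := f.map_add
      map_smul' := by
        intro e v
        obtain ⟨c, rfl⟩ := hbij.2 e
        exact f.map_smul c v }
  have : Module.Finite (Module.End (MonoidAlgebra k G) ρ.asModule) ρ.asModule :=
    Module.Finite.of_restrictScalars_finite k _ _
  obtain ⟨r, hr⟩ := Module.Finite.toModuleEnd_moduleEnd_surjective f'
  have hr' : ρ.asAlgebraHom r = f := LinearMap.ext fun v => LinearMap.congr_fun hr v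
  rw [← hr']
  clear hr hr'
  induction r using MonoidAlgebra.induction_linear with
  | zero => simp
  | add x y hx hy => rw [map_add]; exact add_mem hx hy
  | single g a =>
    rw [Representation.asAlgebraHom_single]
    exact Submodule.smul_mem _ _ (Submodule.subset_span ⟨g, rfl⟩)

theorem Representation.IsIrreducible.exists_finiteIndex_commute {G V : Type*} [Group G]
    [AddCommGroup V] [Module ℂ V] [FiniteDimensional ℂ V] (ρ : Representation ℂ G V)
    [ρ.IsIrreducible] (hu : ∀ g, ∃ k : ℕ, 0 < k ∧ IsNilpotent (ρ g ^ k - 1)) :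
    ∃ H : Subgroup G, H.FiniteIndex ∧ ∀ a ∈ H, ∀ b ∈ H, Commute (ρ a) (ρ b) := by
  let e := LinearMap.toMatrixAlgEquiv (Module.finBasis ℂ V)
  let f : G →* Matrix _ _ ℂ := e.toMulEquiv.toMonoidHom.comp ρ
  have hf : ∀ g, f g = e (ρ g) := fun g => rfl
  have hspan : Submodule.span ℂ (Set.range f) = ⊤ := by
    have h1 : Set.range f = e.toLinearMap '' Set.range ρ := Set.range_comp e ρ
    rw [h1, Submodule.span_image, Representation.IsIrreducible.span_range_eq_top ρ,
      Submodule.map_top, LinearMap.range_eq_top]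
    exact e.surjective
  obtain ⟨H, hH, hcomm⟩ := Matrix.exists_finiteIndex_commute_of_span_eq_top f hspan fun g => by
    obtain ⟨k, hk, hN⟩ := hu g
    refine ⟨k, hk, ?_⟩
    have := hN.map e
    rwa [map_sub, map_pow, map_one] at this
  exact ⟨H, hH, fun a ha b hb => (hcomm a ha b hb).of_map e.injective⟩

theorem IsNilpotent.pow_sub_one_of_comp_injective {R M N : Type*} [Ring R] [AddCommGroup M]
    [AddCommGroup N] [Module R M] [Module R N] {S : Module.End R N} {T : Module.End R M} {k : ℕ}
    (hS : IsNilpotent (S ^ k - 1)) {i : M →ₗ[R] N} (hi : Function.Injective i)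
    (h : S ∘ₗ i = i ∘ₗ T) : IsNilpotent (T ^ k - 1) := by
  obtain ⟨j, hj⟩ := hS
  have h1 : (S ^ k - 1) ∘ₗ i = i ∘ₗ (T ^ k - 1) := by
    rw [LinearMap.sub_comp, LinearMap.comp_sub, Module.End.commute_pow_left_of_commute h]
    rfl
  have h2 := Module.End.commute_pow_left_of_commute h1 j
  refine ⟨j, LinearMap.ext fun x => hi ?_⟩
  rw [hj] at h2
  simpa using (LinearMap.congr_fun h2 x).symm

theorem IsNilpotent.pow_sub_one_of_comp_surjective {R M N : Type*} [Ring R] [AddCommGroup M]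
    [AddCommGroup N] [Module R M] [Module R N] {S : Module.End R M} {T : Module.End R N} {k : ℕ}
    (hS : IsNilpotent (S ^ k - 1)) {p : M →ₗ[R] N} (hp : Function.Surjective p)
    (h : T ∘ₗ p = p ∘ₗ S) : IsNilpotent (T ^ k - 1) := by
  obtain ⟨j, hj⟩ := hS
  have h1 : (T ^ k - 1) ∘ₗ p = p ∘ₗ (S ^ k - 1) := by
    rw [LinearMap.sub_comp, LinearMap.comp_sub, Module.End.commute_pow_left_of_commute h]
    rfl
  have h2 := Module.End.commute_pow_left_of_commute h1 j
  refine ⟨j, LinearMap.ext fun y => ?_⟩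
  obtain ⟨x, rfl⟩ := hp y
  rw [hj] at h2
  simpa using LinearMap.congr_fun h2 x

theorem Representation.eq_one_of_mem_commutator_of_commute {k G V : Type*} [CommRing k] [Group G]
    [AddCommGroup V] [Module k V] (ρ : Representation k G V) {H : Subgroup G} {K : Subgroup H}
    (hcomm : ∀ a ∈ K, ∀ b ∈ K, Commute (ρ a) (ρ b)) : ∀ g ∈ ⁅K, K⁆, ρ g = 1 := by
  let F : H →* (Module.End k V)ˣ := (ρ : G →* Module.End k V).toHomUnits.comp H.subtype
  have hle : ⁅K, K⁆ ≤ F.ker := by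
    rw [Subgroup.commutator_le]
    intro a ha b hb
    rw [MonoidHom.mem_ker, map_commutatorElement, commutatorElement_eq_one_iff_commute]
    exact Units.ext (hcomm a ha b hb)
  exact fun g hg => congrArg Units.val (MonoidHom.mem_ker.1 (hle hg))

/-- If every `ρ g` is virtually unipotent then the image of `ρ` is virtually solvable. -/
theorem Representation.exists_finiteIndex_derivedSeries_trivial {G V : Type*} [Group G]
    [AddCommGroup V] [Module ℂ V] [FiniteDimensional ℂ V] (ρ : Representation ℂ G V)
    (hu : ∀ g, ∃ k : ℕ, 0 < k ∧ IsNilpotent (ρ g ^ k - 1)) :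
    ∃ H : Subgroup G, H.FiniteIndex ∧ ∃ n, ∀ g ∈ derivedSeries H n, ρ g = 1 := by
  induction hd : Module.finrank ℂ V using Nat.strong_induction_on generalizing V with
  | _ d ih =>
  by_cases hred : ∃ W : Submodule ℂ V, W ≠ ⊥ ∧ W ≠ ⊤ ∧ ∀ g, W ≤ W.comap (ρ g)
  · obtain ⟨W, hbot, htop, hW⟩ := hred
    have hlt1 : Module.finrank ℂ W < d := hd ▸ Submodule.finrank_lt htop
    have hlt2 : Module.finrank ℂ (V ⧸ W) < d := by
      have h1 := Submodule.finrank_quotient_add_finrank W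
      have h2 := Submodule.one_le_finrank_iff.2 hbot
      omega
    obtain ⟨H₁, hH₁, n₁, h₁⟩ := ih _ hlt1 (ρ.subrepresentation W hW) (fun g => by
      obtain ⟨k, hk, hN⟩ := hu g
      exact ⟨k, hk, hN.pow_sub_one_of_comp_injective W.subtype_injective rfl⟩) rfl
    obtain ⟨H₂, hH₂, n₂, h₂⟩ := ih _ hlt2 (ρ.quotient W hW) (fun g => by
      obtain ⟨k, hk, hN⟩ := hu g
      exact ⟨k, hk, hN.pow_sub_one_of_comp_surjective W.mkQ_surjective rfl⟩) rfl
    have hmem : ∀ (L : Subgroup G) (hL : H₁ ⊓ H₂ ≤ L) (j : ℕ), j ≤ max n₁ n₂ →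
        ∀ g ∈ derivedSeries (H₁ ⊓ H₂ : Subgroup G) (max n₁ n₂),
          Subgroup.inclusion hL g ∈ derivedSeries L j := fun L hL j hj g hg =>
      map_derivedSeries_le_derivedSeries (Subgroup.inclusion hL) j
        (Subgroup.mem_map_of_mem _ (derivedSeries_antitone _ hj hg))
    have hW1 : ∀ g ∈ derivedSeries (H₁ ⊓ H₂ : Subgroup G) (max n₁ n₂), ∀ w ∈ W, ρ g w = w :=
      fun g hg w hw => congrArg Subtype.val
        (LinearMap.congr_fun (h₁ _ (hmem H₁ inf_le_left n₁ (le_max_left _ _) g hg)) ⟨w, hw⟩)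
    have hW2 : ∀ g ∈ derivedSeries (H₁ ⊓ H₂ : Subgroup G) (max n₁ n₂), ∀ v, ρ g v - v ∈ W :=
      fun g hg v => (Submodule.Quotient.eq W).1
        (LinearMap.congr_fun (h₂ _ (hmem H₂ inf_le_right n₂ (le_max_right _ _) g hg)) (W.mkQ v))
    refine ⟨H₁ ⊓ H₂, inferInstance, max n₁ n₂ + 1, ?_⟩
    have hcomm : ∀ a ∈ derivedSeries (H₁ ⊓ H₂ : Subgroup G) (max n₁ n₂),
        ∀ b ∈ derivedSeries (H₁ ⊓ H₂ : Subgroup G) (max n₁ n₂), Commute (ρ a) (ρ b) := by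
      intro a ha b hb
      refine LinearMap.ext fun v => ?_
      have hab := hW1 a ha _ (hW2 b hb v)
      have hba := hW1 b hb _ (hW2 a ha v)
      rw [map_sub, sub_eq_iff_eq_add] at hab hba
      rw [Module.End.mul_apply, Module.End.mul_apply, hab, hba]
      abel
    rw [derivedSeries_succ]
    exact ρ.eq_one_of_mem_commutator_of_commute hcomm
  · by_cases hV : Subsingleton V
    · exact ⟨⊤, inferInstance, 0, fun g _ => LinearMap.ext fun v => Subsingleton.elim _ _⟩
    rw [not_subsingleton_iff_nontrivial] at hV
    have : ρ.IsIrreducible :=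
      { exists_pair_ne := ⟨⊥, ⊤, fun h =>
          bot_ne_top (α := Submodule ℂ V) (congrArg Subrepresentation.toSubmodule h)⟩
        eq_bot_or_eq_top := fun W => by
          by_contra! h
          refine hred ⟨W.toSubmodule, fun h0 => h.1 ?_, fun h0 => h.2 ?_,
            fun g v hv => W.apply_mem_toSubmodule g hv⟩ <;>
          exact Subrepresentation.toSubmodule_injective h0 }
    obtain ⟨H, hH, hcomm⟩ := Representation.IsIrreducible.exists_finiteIndex_commute ρ hu
    refine ⟨H, hH, 1, ?_⟩
    rw [derivedSeries_one, commutator_def]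
    exact ρ.eq_one_of_mem_commutator_of_commute fun a _ b _ => hcomm a a.2 b b.2

end

/-- A subgroup of `GLₘ(ℂ)` all of whose elements are virtually unipotent contains a
solvable subgroup of finite index. -/
theorem virtually_solvable_of_virtually_unipotent (m : ℕ)
    (G : Subgroup (Matrix.GeneralLinearGroup (Fin m) ℂ))
    (h : ∀ g ∈ G, ∃ k : ℕ, 0 < k ∧
      (((g : Matrix (Fin m) (Fin m) ℂ)) ^ k - 1) ^ m = 0) :
    ∃ H : Subgroup G, H.FiniteIndex ∧ IsSolvable H := by
  let ρ : Representation ℂ G (Fin m → ℂ) :=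
    ((Matrix.toLinAlgEquiv' : Matrix (Fin m) (Fin m) ℂ ≃ₐ[ℂ] _) :
      Matrix (Fin m) (Fin m) ℂ →* Module.End ℂ (Fin m → ℂ)).comp ((Units.coeHom _).comp G.subtype)
  have hρ : ∀ g : G, ρ g = Matrix.toLinAlgEquiv' ((g : GL (Fin m) ℂ) : Matrix (Fin m) (Fin m) ℂ) :=
    fun g => rfl
  obtain ⟨H, hH, n, hn⟩ := Representation.exists_finiteIndex_derivedSeries_trivial ρ fun g => by
    obtain ⟨k, hk, hN⟩ := h g g.2
    refine ⟨k, hk, m, ?_⟩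
    rw [hρ, ← map_pow, ← map_one Matrix.toLinAlgEquiv', ← map_sub, ← map_pow, hN, map_zero]
  refine ⟨H, hH, ⟨n, ?_⟩⟩
  rw [eq_bot_iff]
  intro g hg
  have h1 := hn g hg
  rw [hρ, ← map_one Matrix.toLinAlgEquiv'] at h1
  exact Subtype.ext (Subtype.ext (Units.ext (Matrix.toLinAlgEquiv'.injective h1)))
end

section
/- Let Γ be a non-cyclic free group, each of whose elements acts on C^m by a matrix g* ∈ GL_m(C) via a faithful representation, such that every g* is virtually unipotent. Then a contradiction arises; equivalently, a free group admitting a faithful representation into GL_m(C) by virtually unipotent matrices is cyclic. -/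
open Module in
theorem isNilpotent_of_forall_trace_pow_eq_zero {K V : Type*} [Field K] [CharZero K]
    [AddCommGroup V] [Module K V] [FiniteDimensional K V] (x : End K V)
    (h : ∀ k : ℕ, LinearMap.trace K V (x ^ (k + 1)) = 0) : IsNilpotent x := by
  have htr : ∀ f : Polynomial K, LinearMap.trace K V (x * Polynomial.aeval x f) = 0 := by
    intro f
    induction f using Polynomial.induction_on' with
    | add p q hp hq => rw [map_add, mul_add, map_add, hp, hq, add_zero]
    | monomial n a =>
      rw [Polynomial.aeval_monomial, ← Algebra.smul_def, mul_smul_comm, ← pow_succ', map_smul, h,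
        smul_zero]
  obtain ⟨q, hq, hnd⟩ := Polynomial.exists_eq_pow_rootMultiplicity_mul_and_not_dvd (minpoly K x)
    (minpoly.ne_zero (Algebra.IsIntegral.isIntegral x)) 0
  set n := Polynomial.rootMultiplicity 0 (minpoly K x)
  rw [map_zero, sub_zero] at hq hnd
  have hcop : IsCoprime (Polynomial.X ^ (n + 1)) q :=
    ((Polynomial.irreducible_X.coprime_iff_not_dvd).2 hnd).pow_left
  obtain ⟨u, v, huv⟩ := hcop
  have h0 : x ^ n * Polynomial.aeval x q = 0 := by
    have := minpoly.aeval K x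
    rwa [hq, map_mul, map_pow, Polynomial.aeval_X] at this
  have h1 := congrArg (Polynomial.aeval x) huv
  set e := Polynomial.aeval x (u * Polynomial.X ^ (n + 1)) with he
  have hone : 1 - e = Polynomial.aeval x (v * q) := by
    rw [sub_eq_iff_eq_add', he, ← map_add, huv, map_one]
  have hidem : e * (1 - e) = 0 := by
    rw [hone, he, ← map_mul,
      show u * Polynomial.X ^ (n + 1) * (v * q) =
        (u * v * Polynomial.X) * (Polynomial.X ^ n * q) by ring,
      map_mul, map_mul _ _ q, map_pow, Polynomial.aeval_X, h0, mul_zero]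
  have he0 : e = 0 := by
    refine LinearMap.IsIdempotentElem.eq_zero_of_trace_eq_zero (R := K) ?_ ?_
    · rw [mul_sub, mul_one, sub_eq_zero] at hidem
      exact hidem.symm
    · rw [he, show u * Polynomial.X ^ (n + 1) = Polynomial.X * (u * Polynomial.X ^ n) by ring,
        map_mul, Polynomial.aeval_X, htr]
  refine ⟨n, ?_⟩
  calc x ^ n = x ^ n * (1 - e) := by rw [he0, sub_zero, mul_one]
    _ = x ^ n * Polynomial.aeval x q * Polynomial.aeval x v := by
      rw [hone, mul_comm v q, map_mul, mul_assoc]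
    _ = 0 := by rw [h0, zero_mul]

section Unipotent

attribute [local instance] LieRing.ofAssociativeRing

open Module in
/-- A weak form of Kolchin's theorem: a unipotent representation in characteristic zero admits a
finite filtration on whose graded pieces the group acts trivially. -/
theorem exists_flag_of_unipotent {K V G : Type*} [Field K] [CharZero K]
    [AddCommGroup V] [Module K V] [FiniteDimensional K V] [Group G] (ρ : Representation K G V)
    (hρ : ∀ g, IsNilpotent (ρ g - 1)) :
    ∃ D : ℕ → Submodule K V, D 0 = ⊤ ∧ (∃ c, D c = ⊥) ∧ Antitone D ∧
      ∀ g i, ∀ v ∈ D i, (ρ g - 1) v ∈ D (i + 1) := by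
  let N : Submodule K (End K V) := Submodule.span K (Set.range fun g => ρ g - 1)
  have hmem : ∀ g, ρ g - 1 ∈ N := fun g => Submodule.subset_span ⟨g, rfl⟩
  have hmul : ∀ x ∈ N, ∀ y ∈ N, x * y ∈ N := by
    intro x hx y hy
    induction hx, hy using Submodule.span_induction₂ with
    | mem_mem x y hx hy =>
      obtain ⟨g, rfl⟩ := hx
      obtain ⟨h, rfl⟩ := hy
      have : (ρ g - 1) * (ρ h - 1) = (ρ (g * h) - 1) - (ρ g - 1) - (ρ h - 1) := by
        rw [map_mul]; noncomm_ring
      simp only [this]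
      exact N.sub_mem (N.sub_mem (hmem _) (hmem _)) (hmem _)
    | zero_left y hy => simp
    | zero_right x hx => simp
    | add_left x y z _ _ _ h1 h2 => rw [add_mul]; exact N.add_mem h1 h2
    | add_right x y z _ _ _ h1 h2 => rw [mul_add]; exact N.add_mem h1 h2
    | smul_left r x y _ _ h => rw [smul_mul_assoc]; exact N.smul_mem _ h
    | smul_right r x y _ _ h => rw [mul_smul_comm]; exact N.smul_mem _ h
  have htr : ∀ x ∈ N, LinearMap.trace K V x = 0 := by
    intro x hx
    induction hx using Submodule.span_induction with
    | mem x hx =>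
      obtain ⟨g, rfl⟩ := hx
      exact (LinearMap.isNilpotent_trace_of_isNilpotent (hρ g)).eq_zero
    | zero => simp
    | add x y _ _ h1 h2 => rw [map_add, h1, h2, add_zero]
    | smul r x _ h => rw [map_smul, h, smul_zero]
  have hpow : ∀ x ∈ N, ∀ k : ℕ, x ^ (k + 1) ∈ N := by
    intro x hx k
    induction k with
    | zero => simpa using hx
    | succ k ih => rw [pow_succ]; exact hmul _ ih _ hx
  let L : LieSubalgebra K (End K V) :=
    { N with
      lie_mem' := fun {x y} hx hy => by
        rw [Ring.lie_def]
        exact N.sub_mem (hmul _ hx _ hy) (hmul _ hy _ hx) }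
  have hnil : LieModule.IsNilpotent L V := by
    rw [LieModule.isNilpotent_iff_forall' (R := K)]
    rintro ⟨x, hx⟩
    have : LieModule.toEnd K L V ⟨x, hx⟩ = x := rfl
    rw [this]
    exact isNilpotent_of_forall_trace_pow_eq_zero x fun k => htr _ (hpow x hx k)
  refine ⟨fun i => (LieModule.lowerCentralSeries K L V i).toSubmodule, by simp, ?_, ?_, ?_⟩
  · obtain ⟨c, hc⟩ := (LieModule.isNilpotent_iff K L V).1 hnil
    exact ⟨c, by simp [hc]⟩
  · intro i j hij
    exact LieModule.antitone_lowerCentralSeries K L V hij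
  · intro g i v hv
    change (ρ g - 1) v ∈ LieModule.lowerCentralSeries K L V (i + 1)
    rw [LieModule.lowerCentralSeries_succ]
    exact LieSubmodule.lie_mem_lie (x := (⟨ρ g - 1, hmem g⟩ : L)) (LieSubmodule.mem_top _) hv

end Unipotent

/-- The iterated commutators `[x, [x, …, [x, y]]]`. -/
def engelCommutator {G : Type*} [Group G] (x y : G) : ℕ → G
  | 0 => y
  | n + 1 => x * engelCommutator x y n * (x⁻¹ * (engelCommutator x y n)⁻¹)

theorem map_engelCommutator {G H : Type*} [Group G] [Group H] (f : G →* H) (x y : G) (n : ℕ) :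
    f (engelCommutator x y n) = engelCommutator (f x) (f y) n := by
  induction n with
  | zero => rfl
  | succ n ih => simp only [engelCommutator, map_mul, map_inv, ih]

theorem exists_map_engelCommutator_eq_one {K V G : Type*} [Field K] [CharZero K]
    [AddCommGroup V] [Module K V] [FiniteDimensional K V] [Group G] (ρ : Representation K G V)
    (hρ : ∀ g, IsNilpotent (ρ g - 1)) (x y : G) : ∃ c, ρ (engelCommutator x y c) = 1 := by
  obtain ⟨D, hD0, ⟨c, hc⟩, hanti, hD⟩ := exists_flag_of_unipotent ρ hρ
  have hstab : ∀ g i, ∀ v ∈ D i, ρ g v ∈ D i := by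
    intro g i v hv
    have := (D i).add_mem (hanti (Nat.le_succ i) (hD g i v hv)) hv
    simpa using this
  have key : ∀ j i, ∀ v ∈ D i, (ρ (engelCommutator x y j) - 1) v ∈ D (i + j) := by
    intro j
    induction j with
    | zero =>
      intro i v hv
      exact hanti (Nat.le_succ i) (hD _ i v hv)
    | succ j ih =>
      intro i v hv
      rw [engelCommutator]
      set z := engelCommutator x y j
      have hw : ρ (x⁻¹ * z⁻¹) v ∈ D i := hstab _ _ _ hv
      have heq : ρ (x * z * (x⁻¹ * z⁻¹)) - 1 = ((ρ x - 1) * (ρ z - 1) - (ρ z - 1) * (ρ x - 1)) *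
          ρ (x⁻¹ * z⁻¹) := by
        have h1 : (ρ x - 1) * (ρ z - 1) - (ρ z - 1) * (ρ x - 1) = ρ (x * z) - ρ (z * x) := by
          rw [map_mul, map_mul]; noncomm_ring
        rw [h1, sub_mul, ← map_mul, ← map_mul, show z * x * (x⁻¹ * z⁻¹) = 1 by group, map_one]
      rw [heq]
      refine (D _).sub_mem ?_ ?_
      · exact hD _ _ _ (ih _ _ hw)
      · have := ih _ _ (hD x _ _ hw)
        rwa [add_right_comm] at this
  refine ⟨c, sub_eq_zero.1 (LinearMap.ext fun v => ?_)⟩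
  have := key c 0 v (hD0 ▸ Submodule.mem_top)
  rw [zero_add, hc] at this
  simpa using this

/-- If `A ≡ 1` modulo the kernel of `π`, `A ^ t` is unipotent and `t` is nonzero in the residue
field, then `A` is unipotent. -/
theorem Matrix.sub_one_pow_eq_zero_of_congr {R K k : Type*} [CommRing R] [Field K] [Field k]
    (f : R →+* K) (hf : Function.Injective f) (π : R →+* k) {m t d : ℕ}
    (A : Matrix (Fin m) (Fin m) R) (hA : A.map π = 1) (ht : (t : k) ≠ 0)
    (h : ((A.map f) ^ t - 1) ^ d = 0) : (A.map f - 1) ^ d = 0 := by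
  set S : Matrix (Fin m) (Fin m) R := ∑ i ∈ Finset.range t, A ^ i with hS
  have hπS : π.mapMatrix S = (t : Matrix (Fin m) (Fin m) k) := by
    have : π.mapMatrix A = 1 := hA
    rw [hS, map_sum]
    simp [this, -RingHom.mapMatrix_apply]
  have hdet : S.det ≠ 0 := by
    intro h0
    have h1 : (π.mapMatrix S).det = 0 := by rw [← RingHom.map_det, h0, map_zero]
    rw [hπS, ← nsmul_one, ← Nat.cast_smul_eq_nsmul k, Matrix.det_smul, Matrix.det_one, mul_one] at h1
    exact pow_ne_zero _ ht h1
  have hu : IsUnit (f.mapMatrix S) := by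
    rw [Matrix.isUnit_iff_isUnit_det, ← RingHom.map_det, isUnit_iff_ne_zero]
    exact (map_ne_zero_iff f hf).2 hdet
  have hfS : f.mapMatrix S = ∑ i ∈ Finset.range t, (A.map f) ^ i := by
    rw [hS, map_sum]
    exact Finset.sum_congr rfl fun i _ => map_pow f.mapMatrix A i
  have hc : Commute (A.map f - 1) (f.mapMatrix S) := by
    rw [hfS]
    exact Commute.sum_right _ _ _ fun i _ =>
      ((Commute.refl _).pow_right i).sub_left (Commute.one_left _)
  rw [← mul_geom_sum, ← hfS, hc.mul_pow] at h
  exact (hu.pow d).mul_left_eq_zero.1 h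

theorem Int.isJacobsonRing_s9 : IsJacobsonRing ℤ := by
  refine isJacobsonRing_iff_prime_eq.2 fun P hP => ?_
  by_cases hP0 : P = ⊥
  · subst hP0
    refine le_antisymm (fun x hx => ?_) Ideal.le_jacobson
    obtain ⟨p, hle, hp⟩ := Nat.exists_infinite_primes (x.natAbs + 1)
    have hmax : (Ideal.span {(p : ℤ)}).IsMaximal :=
      PrincipalIdealRing.isMaximal_of_irreducible (Nat.prime_iff_prime_int.1 hp).irreducible
    have hmem : x ∈ Ideal.span {(p : ℤ)} := Ideal.mem_sInf.1 hx ⟨bot_le, hmax⟩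
    rw [Ideal.mem_span_singleton, Int.natCast_dvd] at hmem
    have := Nat.eq_zero_of_dvd_of_lt hmem hle
    simpa using this
  · have := hP.isMaximal hP0
    exact Ideal.jacobson_eq_self_of_isMaximal

/-- For a group of matrices over a finitely generated domain in which `q` is invertible, the
congruence subgroup at a maximal ideal has no eigenvalue that is a nontrivial root of unity of order
prime to the residue characteristic `p`, and `p` does not divide `q`. -/
theorem exists_finiteIndex_congruence_subgroup {F : Type*} [Group F] {m : ℕ}
    (ρ : F →* Matrix (Fin m) (Fin m) ℂ) (R : Subalgebra ℤ ℂ) (hR : R.FG)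
    (hρ : ∀ w i j, ρ w i j ∈ R) (q : ℕ) (hq0 : q ≠ 0) (hq : (q : ℂ)⁻¹ ∈ R) :
    ∃ p : ℕ, p.Prime ∧ ¬ p ∣ q ∧ ∃ H : Subgroup F, H.Normal ∧ H.FiniteIndex ∧
      ∀ w ∈ H, ∀ t d : ℕ, ¬ p ∣ t → (ρ w ^ t - 1) ^ d = 0 → (ρ w - 1) ^ d = 0 := by
  obtain ⟨𝔪, h𝔪⟩ := Ideal.exists_maximal R
  let k := R ⧸ 𝔪
  let : Field k := Ideal.Quotient.field 𝔪
  have : Algebra.FiniteType ℤ R := R.fg_iff_finiteType.1 hR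
  have : Algebra.FiniteType ℤ k := inferInstanceAs (Algebra.FiniteType ℤ (R ⧸ 𝔪))
  have := Int.isJacobsonRing_s9
  have : Module.Finite ℤ k := finite_of_finite_type_of_isJacobsonRing ℤ k
  let p := ringChar k
  have hp0 : p ≠ 0 := by
    intro h0
    have : CharZero k := (CharP.ringChar_zero_iff_CharZero k).1 h0
    exact Int.not_isField (isField_of_isIntegral_of_isField
      (algebraMap ℤ k).injective_int (Field.toIsField k))
  have hp : p.Prime := (CharP.char_is_prime_or_zero k p).resolve_right hp0
  have : Finite k := by
    refine Module.finite_of_fg_torsion k fun {x} => ?_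
    refine ⟨⟨(p : ℤ), mem_nonZeroDivisors_of_ne_zero (by exact_mod_cast hp0)⟩, ?_⟩
    change (p : ℤ) • x = 0
    rw [natCast_zsmul, nsmul_eq_mul, ringChar.Nat.cast_ringChar, zero_mul]
  let π : R →+* k := Ideal.Quotient.mk 𝔪
  let φ : F →* Matrix (Fin m) (Fin m) R :=
    { toFun := fun w => Matrix.of fun i j => ⟨ρ w i j, hρ w i j⟩
      map_one' := by
        ext i j
        simp [Matrix.one_apply]
        split_ifs <;> rfl
      map_mul' := fun a b => by
        ext i j
        simp [Matrix.mul_apply] }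
  have hφ : ∀ w, (φ w).map R.val = ρ w := fun w => rfl
  let ψ : F →* (Matrix (Fin m) (Fin m) k)ˣ :=
    ((π.mapMatrix : Matrix (Fin m) (Fin m) R →+* _).toMonoidHom.comp φ).toHomUnits
  refine ⟨p, hp, ?_, ψ.ker, inferInstance, inferInstance, ?_⟩
  · intro hdvd
    have h1 : (q : k) = 0 := (ringChar.spec k q).2 hdvd
    have h2 : (q : R) * ⟨(q : ℂ)⁻¹, hq⟩ = 1 := by
      ext
      simp [hq0]
    have h3 := congrArg π h2
    rw [map_mul, map_natCast, h1, zero_mul, map_one] at h3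
    exact zero_ne_one h3
  · intro w hw t d ht h
    rw [← hφ] at h ⊢
    refine Matrix.sub_one_pow_eq_zero_of_congr (R.val : R →+* ℂ) Subtype.val_injective π
      (φ w) ?_ ?_ h
    · exact congrArg Units.val hw
    · exact fun h0 => ht ((ringChar.spec k t).1 h0)

theorem exists_fg_subalgebra_forall_entries_mem {α : Type*} [Finite α] {m : ℕ}
    (ρ : FreeGroup α →* Matrix (Fin m) (Fin m) ℂ) (z : ℂ) :
    ∃ R : Subalgebra ℤ ℂ, R.FG ∧ z ∈ R ∧ ∀ w i j, ρ w i j ∈ R := by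
  let S : Set ℂ := insert z ((Set.range fun x : α × Fin m × Fin m =>
      ρ (FreeGroup.of x.1) x.2.1 x.2.2) ∪
    (Set.range fun x : α × Fin m × Fin m => ρ (FreeGroup.of x.1)⁻¹ x.2.1 x.2.2))
  have hS : S.Finite := ((Set.finite_range _).union (Set.finite_range _)).insert z
  refine ⟨Algebra.adjoin ℤ S, Subalgebra.fg_def.2 ⟨S, hS, rfl⟩,
    Algebra.subset_adjoin (Or.inl rfl), ?_⟩
  intro w
  induction w using FreeGroup.induction_on with
  | C1 =>
    intro i j
    rw [map_one, Matrix.one_apply]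
    split_ifs
    · exact one_mem _
    · exact zero_mem _
  | of a => exact fun i j => Algebra.subset_adjoin (Or.inr (Or.inl ⟨(a, i, j), rfl⟩))
  | inv_of a _ => exact fun i j => Algebra.subset_adjoin (Or.inr (Or.inr ⟨(a, i, j), rfl⟩))
  | mul x y hx hy =>
    intro i j
    rw [map_mul, Matrix.mul_apply]
    exact sum_mem fun l _ => mul_mem (hx _ _) (hy _ _)

theorem engelCommutator_dilation_translation_ne_one (n : ℕ) (hn : n ≠ 0) (c : ℕ) :
    engelCommutator (Equiv.mulRight₀ (2 : ℚ) two_ne_zero ^ n) (Equiv.addRight (1 : ℚ) ^ n) c ≠ 1 := by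
  have hS : ∀ x, (Equiv.mulRight₀ (2 : ℚ) two_ne_zero ^ n) x = x * 2 ^ n := by
    intro x
    clear hn
    induction n generalizing x with
    | zero => simp
    | succ n ih => rw [pow_succ, Equiv.Perm.mul_apply, ih, pow_succ']; simp [mul_assoc]
  have hS' : ∀ x, (Equiv.mulRight₀ (2 : ℚ) two_ne_zero ^ n)⁻¹ x = x / 2 ^ n := by
    intro x
    rw [Equiv.Perm.inv_eq_iff_eq, hS, div_mul_cancel₀ _ (by positivity)]
  have hT : ∀ x, (Equiv.addRight (1 : ℚ) ^ n) x = x + n := by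
    intro x
    simp
  have key : ∀ x, engelCommutator (Equiv.mulRight₀ (2 : ℚ) two_ne_zero ^ n)
      (Equiv.addRight (1 : ℚ) ^ n) c x = x + (2 ^ n - 1) ^ c * n := by
    induction c with
    | zero => intro x; rw [engelCommutator, hT]; ring
    | succ c ih =>
      intro x
      have hinv : ∀ y, (engelCommutator (Equiv.mulRight₀ (2 : ℚ) two_ne_zero ^ n)
          (Equiv.addRight (1 : ℚ) ^ n) c)⁻¹ y = y - (2 ^ n - 1) ^ c * n := by
        intro y
        rw [Equiv.Perm.inv_eq_iff_eq, ih]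
        ring
      rw [engelCommutator]
      simp only [Equiv.Perm.mul_apply, hinv, hS', ih, hS]
      field_simp
      ring
  intro h
  have h0 := key 0
  rw [h, Equiv.Perm.one_apply, zero_add] at h0
  have h2 : (1 : ℚ) < 2 ^ n := one_lt_pow₀ one_lt_two hn
  have h3 : (0 : ℚ) < (2 ^ n - 1) ^ c * n :=
    mul_pos (pow_pos (sub_pos.2 h2) c) (by exact_mod_cast Nat.pos_of_ne_zero hn)
  exact h3.ne h0

/-- Some congruence subgroup of finite index is unipotent, hence satisfies an Engel identity, which
fails in the affine group of the line. -/
theorem not_injective_of_virtually_unipotent {m : ℕ}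
    (ρ : FreeGroup Bool →* Matrix (Fin m) (Fin m) ℂ)
    (hunip : ∀ g, ∃ k : ℕ, 0 < k ∧ (ρ g ^ k - 1) ^ m = 0) : ¬ Function.Injective ρ := by
  intro hinj
  obtain ⟨R, hR, h1, hρR⟩ := exists_fg_subalgebra_forall_entries_mem ρ 1
  obtain ⟨p, hp, -, H, hHn, hHf, hH⟩ :=
    exists_finiteIndex_congruence_subgroup ρ R hR hρR 1 one_ne_zero (by simp)
  obtain ⟨R', hR', hpR', hρR'⟩ := exists_fg_subalgebra_forall_entries_mem ρ (p : ℂ)⁻¹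
  obtain ⟨p', hp', hpp', H', hHn', hHf', hH'⟩ :=
    exists_finiteIndex_congruence_subgroup ρ R' hR' hρR' p hp.ne_zero hpR'
  have hU : ∀ w ∈ H ⊓ H', (ρ w - 1) ^ m = 0 := by
    rintro w ⟨hw, hw'⟩
    obtain ⟨k, hk, h⟩ := hunip w
    obtain ⟨s, t, hpt, rfl⟩ := Nat.exists_eq_pow_mul_and_not_dvd hk.ne' p hp.ne_one
    rw [pow_mul, ← map_pow] at h
    have h2 := hH _ (pow_mem hw _) t m hpt h
    rw [map_pow] at h2
    exact hH' w hw' _ m (fun hd => hpp' (hp'.dvd_of_dvd_pow hd)) h2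
  set n := (H ⊓ H').index
  have hn : n ≠ 0 := Subgroup.FiniteIndex.index_ne_zero
  let σ : Representation ℂ ↥(H ⊓ H') (Fin m → ℂ) :=
    ((Matrix.toLinAlgEquiv' : Matrix (Fin m) (Fin m) ℂ ≃ₐ[ℂ] _) :
      Matrix (Fin m) (Fin m) ℂ →* Module.End ℂ (Fin m → ℂ)).comp (ρ.comp (H ⊓ H').subtype)
  have hσ : ∀ g, σ g = Matrix.toLinAlgEquiv' (ρ g) := fun _ => rfl
  have hσn : ∀ g, IsNilpotent (σ g - 1) := by
    intro g
    refine ⟨m, ?_⟩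
    have : σ g - 1 = Matrix.toLinAlgEquiv' (ρ g - 1) := by
      rw [map_sub, map_one]
      rfl
    rw [this, ← map_pow, hU g g.2, map_zero]
  let x : ↥(H ⊓ H') := ⟨_, (H ⊓ H').pow_index_mem (FreeGroup.of true)⟩
  let y : ↥(H ⊓ H') := ⟨_, (H ⊓ H').pow_index_mem (FreeGroup.of false)⟩
  obtain ⟨c, hc⟩ := exists_map_engelCommutator_eq_one σ hσn x y
  have hc' : engelCommutator (FreeGroup.of true ^ n) (FreeGroup.of false ^ n) c = 1 := by
    apply hinj
    rw [map_one]
    apply (Matrix.toLinAlgEquiv' : Matrix (Fin m) (Fin m) ℂ ≃ₐ[ℂ] _).injective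
    rw [map_one, ← hc, hσ]
    congr 2
    exact (map_engelCommutator (H ⊓ H').subtype x y c).symm
  have hd := congrArg (FreeGroup.lift fun b : Bool =>
    if b then Equiv.mulRight₀ (2 : ℚ) two_ne_zero else Equiv.addRight (1 : ℚ)) hc'
  rw [map_engelCommutator, map_pow, map_pow, FreeGroup.lift_apply_of, FreeGroup.lift_apply_of,
    map_one] at hd
  exact engelCommutator_dilation_translation_ne_one n hn c hd

/-- A free group admitting a faithful representation into `GLₘ(ℂ)` by virtually unipotent
matrices is cyclic. -/
theorem cyclic_of_faithful_virtually_unipotent (Γ : Type*) [Group Γ] [IsFreeGroup Γ]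
    (m : ℕ) (ρ : Γ →* Matrix.GeneralLinearGroup (Fin m) ℂ)
    (hinj : Function.Injective ρ)
    (hunip : ∀ g : Γ, ∃ k : ℕ, 0 < k ∧
      (((ρ g : Matrix (Fin m) (Fin m) ℂ)) ^ k - 1) ^ m = 0) :
    IsCyclic Γ := by
  let e := IsFreeGroup.toFreeGroup Γ
  rcases subsingleton_or_nontrivial (IsFreeGroup.Generators Γ) with hs | hs
  · suffices IsCyclic (FreeGroup (IsFreeGroup.Generators Γ)) from
      isCyclic_of_surjective e.symm e.symm.surjective
    rcases isEmpty_or_nonempty (IsFreeGroup.Generators Γ) with he | ⟨⟨a⟩⟩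
    · infer_instance
    · have := uniqueOfSubsingleton a
      infer_instance
  · exfalso
    obtain ⟨a, b, hab⟩ := exists_pair_ne (IsFreeGroup.Generators Γ)
    have hf : Function.Injective fun x : Bool => if x then a else b := by
      intro x y hxy
      cases x <;> cases y <;> simp_all [eq_comm]
    let ι : FreeGroup Bool →* Γ := e.symm.toMonoidHom.comp (FreeGroup.map fun x => if x then a else b)
    have hι : Function.Injective ι := e.symm.injective.comp (FreeGroup.map_injective hf)
    exact not_injective_of_virtually_unipotent
      ((Units.coeHom (Matrix (Fin m) (Fin m) ℂ)).comp (ρ.comp ι)) (fun g => hunip (ι g))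
      (Units.val_injective.comp (hinj.comp hι))
end
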